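/- arXiv:1908.11579 — 4 statements merged into one kernel-verified Lean document; each statement's English description precedes it below -/
import Mathlib

section
/- (Yosida-type vanishing lemma, continuous version) Let T > 0 and let g : [0,T] → ℂ be continuous. If there exists M > 0 such that |∫₀ᵀ e^{αt} g(t) dt| < M for every real α > 1, then g(t) = 0 for all t ∈ [0,T]. -/
open MeasureTheory

lemma Real.hasSum_pow_succ_div_factorial (y : ℝ) :
    HasSum (fun k : ℕ => y ^ (k + 1) / ((k + 1).factorial : ℝ)) (Real.exp y - 1) := by
  have h : HasSum (fun k : ℕ => y ^ k / (k.factorial : ℝ)) (Real.exp y) := by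
    rw [Real.exp_eq_exp_ℝ]
    exact NormedSpace.expSeries_div_hasSum_exp y
  simpa using (hasSum_nat_add_iff' 1).2 h

/-- Expanding `exp (-exp (β * (t - s))) - 1` in powers of `exp (β * t)` turns a uniform bound on
the exponential moments of `G` into a bound on the integral of `G` against this kernel. -/
lemma norm_integral_doubleExp_sub_one_smul_le {T M β s : ℝ} {G : ℝ → ℂ} (hG : Continuous G)
    (hβ : 1 < β)
    (hbound : ∀ α : ℝ, 1 < α →
      ‖∫ t in (0 : ℝ)..T, Complex.exp ((α : ℂ) * (t : ℂ)) * G t‖ < M) :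
    ‖∫ t in (0 : ℝ)..T, (Real.exp (-Real.exp (β * (t - s))) - 1) • G t‖
      ≤ (Real.exp (Real.exp (-(β * s))) - 1) * M := by
  have hsum : HasSum
      (fun k : ℕ => ∫ t in (0 : ℝ)..T,
        ((-Real.exp (β * (t - s))) ^ (k + 1) / ((k + 1).factorial : ℝ)) • G t)
      (∫ t in (0 : ℝ)..T, (Real.exp (-Real.exp (β * (t - s))) - 1) • G t) := by
    have hb (t : ℝ) := (Real.hasSum_pow_succ_div_factorial (Real.exp (β * (t - s)))).mul_right ‖G t‖
    refine intervalIntegral.hasSum_integral_of_dominated_convergence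
      (fun k t => Real.exp (β * (t - s)) ^ (k + 1) / ((k + 1).factorial : ℝ) * ‖G t‖)
      (fun k => ?_) (fun k => ?_) ?_ ?_ ?_
    · exact Continuous.aestronglyMeasurable (by fun_prop)
    · refine .of_forall fun t _ => le_of_eq ?_
      rw [norm_smul, norm_div, norm_pow, norm_neg, Real.norm_of_nonneg (Real.exp_pos _).le,
        RCLike.norm_natCast]
    · exact .of_forall fun t _ => (hb t).summable
    · simp_rw [fun t => (hb t).tsum_eq]
      exact Continuous.intervalIntegrable (by fun_prop) _ _
    · exact .of_forall fun t _ =>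
        (Real.hasSum_pow_succ_div_factorial (-Real.exp (β * (t - s)))).smul_const (G t)
  have hmaj := (Real.hasSum_pow_succ_div_factorial (Real.exp (-(β * s)))).mul_right M
  rw [← hsum.tsum_eq]
  refine tsum_of_norm_bounded hmaj fun k => ?_
  have hα : 1 < ((k : ℝ) + 1) * β := by nlinarith [(Nat.cast_nonneg k : (0 : ℝ) ≤ k)]
  have hterm : (∫ t in (0 : ℝ)..T,
        ((-Real.exp (β * (t - s))) ^ (k + 1) / ((k + 1).factorial : ℝ)) • G t)
      = ((-Real.exp (-(β * s))) ^ (k + 1) / ((k + 1).factorial : ℝ)) •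
        ∫ t in (0 : ℝ)..T, Complex.exp (((((k : ℝ) + 1) * β : ℝ) : ℂ) * (t : ℂ)) * G t := by
    rw [← intervalIntegral.integral_smul]
    refine intervalIntegral.integral_congr fun t _ => ?_
    have he : Complex.exp (((((k : ℝ) + 1) * β : ℝ) : ℂ) * (t : ℂ))
        = ((Real.exp (β * t) ^ (k + 1) : ℝ) : ℂ) := by
      rw [← Real.exp_nat_mul]
      push_cast
      ring_nf
    have hr : Real.exp (β * (t - s)) = Real.exp (-(β * s)) * Real.exp (β * t) := by
      rw [← Real.exp_add]
      ring_nf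
    simp only [he, hr, Complex.real_smul]
    push_cast
    rw [← neg_mul, mul_pow]
    ring
  rw [hterm, norm_smul, norm_div, norm_pow, norm_neg, Real.norm_of_nonneg (Real.exp_pos _).le,
    RCLike.norm_natCast]
  gcongr
  exact (hbound _ hα).le

lemma tendsto_integral_doubleExp_sub_one_smul {T s : ℝ} {G : ℝ → ℂ} (hG : Continuous G)
    (hs : 0 ≤ s) (hsT : s ≤ T) :
    Filter.Tendsto
      (fun β : ℝ => ∫ t in (0 : ℝ)..T, (Real.exp (-Real.exp (β * (t - s))) - 1) • G t)
      Filter.atTop (nhds (-∫ t in s..T, G t)) := by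
  have hlim : ∫ t in (0 : ℝ)..T, (Set.Ioc s T).indicator (fun t => -G t) t
      = -∫ t in s..T, G t := by
    rw [intervalIntegral.integral_of_le (hs.trans hsT), setIntegral_indicator measurableSet_Ioc,
      Set.inter_eq_right.2 (Set.Ioc_subset_Ioc_left hs), integral_neg,
      intervalIntegral.integral_of_le hsT]
  rw [← hlim]
  refine intervalIntegral.tendsto_integral_filter_of_dominated_convergence (fun t => ‖G t‖)
    (.of_forall fun β => Continuous.aestronglyMeasurable (by fun_prop))
    (.of_forall fun β => .of_forall fun t _ => ?_)
    (hG.norm.intervalIntegrable _ _) ?_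
  · rw [norm_smul]
    refine mul_le_of_le_one_left (norm_nonneg _) ?_
    rw [Real.norm_eq_abs, abs_le]
    have h1 := Real.exp_pos (-Real.exp (β * (t - s)))
    have h2 : Real.exp (-Real.exp (β * (t - s))) ≤ 1 :=
      Real.exp_le_one_iff.2 (neg_nonpos.2 (Real.exp_pos _).le)
    constructor <;> linarith
  · filter_upwards [Measure.ae_ne volume s] with t hts ht
    rw [Set.uIoc_of_le (hs.trans hsT)] at ht
    rcases lt_or_gt_of_ne hts with h | h
    · rw [Set.indicator_of_notMem (fun hm => absurd hm.1 h.not_gt)]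
      have h1 : Filter.Tendsto (fun β : ℝ => Real.exp (β * (t - s))) Filter.atTop (nhds 0) :=
        Real.tendsto_exp_atBot.comp (Filter.tendsto_id.atTop_mul_const_of_neg (sub_neg.2 h))
      have h2 := (((Real.continuous_exp.tendsto _).comp h1.neg).sub_const 1).smul_const (G t)
      simpa using h2
    · rw [Set.indicator_of_mem (Set.mem_Ioc.2 ⟨h, ht.2⟩)]
      have h1 : Filter.Tendsto (fun β : ℝ => Real.exp (β * (t - s))) Filter.atTop Filter.atTop :=
        Real.tendsto_exp_atTop.comp (Filter.tendsto_id.atTop_mul_const (sub_pos.2 h))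
      have h2 := ((Real.tendsto_exp_neg_atTop_nhds_zero.comp h1).sub_const 1).smul_const (G t)
      simpa using h2

lemma integral_eq_zero_of_exp_moments_bounded {T M s : ℝ} {G : ℝ → ℂ} (hG : Continuous G)
    (hs : 0 < s) (hsT : s ≤ T)
    (hbound : ∀ α : ℝ, 1 < α →
      ‖∫ t in (0 : ℝ)..T, Complex.exp ((α : ℂ) * (t : ℂ)) * G t‖ < M) :
    ∫ t in s..T, G t = 0 := by
  have hz : Filter.Tendsto (fun β : ℝ => (Real.exp (Real.exp (-(β * s))) - 1) * M)
      Filter.atTop (nhds 0) := by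
    have h1 : Filter.Tendsto (fun β : ℝ => Real.exp (-(β * s))) Filter.atTop (nhds 0) :=
      Real.tendsto_exp_neg_atTop_nhds_zero.comp (Filter.tendsto_id.atTop_mul_const hs)
    simpa using (((Real.continuous_exp.tendsto _).comp h1).sub_const 1).mul_const M
  have h0 := squeeze_zero_norm'
    ((Filter.eventually_gt_atTop 1).mono fun β hβ =>
      norm_integral_doubleExp_sub_one_smul_le (s := s) hG hβ hbound) hz
  exact neg_eq_zero.1
    (tendsto_nhds_unique (tendsto_integral_doubleExp_sub_one_smul hG hs.le hsT) h0)

/-- **Yosida-type vanishing lemma, continuous version.**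
If `g : [0,T] → ℂ` is continuous and `|∫₀ᵀ e^{αt} g(t) dt| < M` for every real `α > 1`,
then `g ≡ 0` on `[0,T]`. -/
theorem yosida_vanishing_continuous (T : ℝ) (hT : 0 < T) (g : ℝ → ℂ)
    (hg : ContinuousOn g (Set.Icc 0 T))
    (M : ℝ) (hM : 0 < M)
    (hbound : ∀ α : ℝ, 1 < α →
      ‖∫ t in (0:ℝ)..T, Complex.exp ((α : ℂ) * (t : ℂ)) * g t‖ < M) :
    ∀ t ∈ Set.Icc (0:ℝ) T, g t = 0 := by
  set G : ℝ → ℂ := Set.IccExtend hT.le ((Set.Icc 0 T).domRestrict g)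
  have hG : Continuous G := hg.domRestrict.Icc_extend'
  have hGg : ∀ t ∈ Set.Icc (0 : ℝ) T, G t = g t := fun t ht =>
    Set.IccExtend_of_mem hT.le _ ht
  have hboundG : ∀ α : ℝ, 1 < α →
      ‖∫ t in (0 : ℝ)..T, Complex.exp ((α : ℂ) * (t : ℂ)) * G t‖ < M := by
    intro α hα
    rw [intervalIntegral.integral_congr (g := fun t : ℝ => Complex.exp ((α : ℂ) * (t : ℂ)) * g t)]
    · exact hbound α hα
    · intro t ht
      rw [Set.uIcc_of_le hT.le] at ht
      simp only [hGg t ht]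
  have hzero : Set.EqOn G 0 (Set.Ioo 0 T) := by
    intro s hs
    have hd : HasDerivAt (fun u => ∫ t in u..T, G t) (-G s) s :=
      intervalIntegral.integral_hasDerivAt_left (hG.intervalIntegrable _ _)
        (hG.stronglyMeasurableAtFilter _ _) hG.continuousAt
    have hc : (fun u => ∫ t in u..T, G t) =ᶠ[nhds s] fun _ => 0 := by
      filter_upwards [Ioo_mem_nhds hs.1 hs.2] with u hu
      exact integral_eq_zero_of_exp_moments_bounded hG hu.1 hu.2.le hboundG
    exact neg_eq_zero.1 (hd.unique ((hasDerivAt_const s (0 : ℂ)).congr_of_eventuallyEq hc))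
  intro t ht
  rw [← hGg t ht]
  refine hzero.closure hG continuous_const ?_
  rwa [closure_Ioo hT.ne]
end

section
/- (ODE form of the global relation on the half line) Let T > 0 and let u : [0,∞) × [0,T] → ℂ be continuous, twice continuously differentiable in x and once in t on (0,∞) × (0,T), and satisfy the heat equation u_t = u_xx there. Assume that for each t ∈ (0,T) the functions x ↦ u(x,t), x ↦ u_x(x,t), x ↦ u_xx(x,t) and x ↦ u_t(x,t) are integrable on (0,∞), that u(x,t) → 0 and u_x(x,t) → 0 as x → ∞ for each t, and that x ↦ u_t(x,t) is dominated, locally uniformly in t, by a fixed integrable function on (0,∞). Then for every λ ∈ ℂ with Im λ ≤ 0 and every t ∈ (0,T), the half-line Fourier transform û(λ,t) is differentiable in t and satisfies d/dt û(λ,t) + λ² û(λ,t) = −u_x(0,t) − iλ u(0,t). -/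
open MeasureTheory Filter

/-- The half-line Fourier transform `f̂(λ) = ∫₀^∞ e^{-iλx} f(x) dx`. -/
noncomputable def halfFourier (f : ℝ → ℂ) (l : ℂ) : ℂ :=
  ∫ x in Set.Ioi (0:ℝ), Complex.exp (-Complex.I * l * (x : ℂ)) * f x

/-- The Fourier kernel `e^{-iλx}` is bounded by `1` for `x ≥ 0` when `Im λ ≤ 0`. -/
lemma norm_exp_neg_I_mul_le_one {l : ℂ} (hl : l.im ≤ 0) {x : ℝ} (hx : 0 ≤ x) :
    ‖Complex.exp (-Complex.I * l * (x : ℂ))‖ ≤ 1 := by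
  rw [Complex.norm_exp, Real.exp_le_one_iff]
  simpa using mul_nonpos_of_nonpos_of_nonneg hl hx

lemma hasDerivAt_exp_neg_I_mul (l : ℂ) (x : ℝ) :
    HasDerivAt (fun y : ℝ => Complex.exp (-Complex.I * l * (y : ℂ)))
      (Complex.exp (-Complex.I * l * (x : ℂ)) * (-Complex.I * l)) x := by
  simpa using ((Complex.ofRealCLM.hasDerivAt (x := x)).const_mul (-Complex.I * l)).cexp

lemma continuous_exp_neg_I_mul (l : ℂ) :
    Continuous fun x : ℝ => Complex.exp (-Complex.I * l * (x : ℂ)) := by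
  fun_prop

lemma integrableOn_exp_neg_I_mul {f : ℝ → ℂ} (hf : IntegrableOn f (Set.Ioi 0)) {l : ℂ}
    (hl : l.im ≤ 0) :
    IntegrableOn (fun x : ℝ => Complex.exp (-Complex.I * l * (x : ℂ)) * f x) (Set.Ioi 0) := by
  refine Integrable.mono hf
    ((continuous_exp_neg_I_mul l).aestronglyMeasurable.mul hf.aestronglyMeasurable) ?_
  filter_upwards [ae_restrict_mem measurableSet_Ioi] with x hx
  rw [norm_mul]
  exact mul_le_of_le_one_left (norm_nonneg _) (norm_exp_neg_I_mul_le_one hl (le_of_lt hx))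

/-- The half-line Fourier transform of a second derivative. -/
lemma halfFourier_second_deriv {f f' f'' : ℝ → ℂ}
    (hf : ∀ x ∈ Set.Ioi (0:ℝ), HasDerivAt f (f' x) x)
    (hf' : ∀ x ∈ Set.Ioi (0:ℝ), HasDerivAt f' (f'' x) x)
    (hf_cont : ContinuousWithinAt f (Set.Ici 0) 0)
    (hf'_cont : ContinuousWithinAt f' (Set.Ici 0) 0)
    (hf_int : IntegrableOn f (Set.Ioi 0)) (hf''_int : IntegrableOn f'' (Set.Ioi 0))
    (hf_decay : Tendsto f atTop (nhds 0)) (hf'_decay : Tendsto f' atTop (nhds 0))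
    {l : ℂ} (hl : l.im ≤ 0) :
    halfFourier f'' l = -(l ^ 2) * halfFourier f l - f' 0 - Complex.I * l * f 0 := by
  have hint := integrableOn_exp_neg_I_mul hf_int hl
  have hint'' := integrableOn_exp_neg_I_mul hf''_int hl
  have key := integral_Ioi_of_hasDerivAt_of_tendsto
    (f := fun x : ℝ => Complex.exp (-Complex.I * l * (x : ℂ)) * (f' x + Complex.I * l * f x))
    (f' := fun x : ℝ => Complex.exp (-Complex.I * l * (x : ℂ)) * f'' x +
      l ^ 2 * (Complex.exp (-Complex.I * l * (x : ℂ)) * f x)) (a := 0) (m := 0)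
    ((continuous_exp_neg_I_mul l).continuousWithinAt.mul
      (hf'_cont.add (continuousWithinAt_const.mul hf_cont)))
    (fun x hx => by
      refine ((hasDerivAt_exp_neg_I_mul l x).mul
        ((hf' x hx).add ((hf x hx).const_mul (Complex.I * l)))).congr_deriv ?_
      simp only [Pi.add_apply]
      linear_combination
        (-(Complex.exp (-Complex.I * l * (x : ℂ))) * l ^ 2 * f x) * Complex.I_sq)
    (hint''.add (hint.const_mul (l ^ 2)))
    (by
      have hlim : Tendsto (fun x => ‖f' x + Complex.I * l * f x‖) atTop (nhds 0) := by
        simpa using (hf'_decay.add (hf_decay.const_mul (Complex.I * l))).norm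
      refine squeeze_zero_norm' ?_ hlim
      filter_upwards [eventually_ge_atTop 0] with x hx
      rw [norm_mul]
      exact mul_le_of_le_one_left (norm_nonneg _) (norm_exp_neg_I_mul_le_one hl hx))
  rw [integral_add hint'' (hint.const_mul _), integral_const_mul] at key
  simp only [Complex.ofReal_zero, mul_zero, Complex.exp_zero, one_mul] at key
  unfold halfFourier
  linear_combination key

/-- **ODE form of the global relation on the half line.**
For a classical solution of the heat equation on the half line with the stated
integrability, decay and domination assumptions, the half-line Fourier transform
`û(λ,t)` satisfies `d/dt û(λ,t) + λ² û(λ,t) = -u_x(0,t) - iλ u(0,t)` for `Im λ ≤ 0`. -/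
theorem halfline_global_relation_ODE (T : ℝ) (hT : 0 < T)
    (u ux uxx ut : ℝ → ℝ → ℂ)
    (hu_cont : ContinuousOn (fun p : ℝ × ℝ => u p.1 p.2) (Set.Ici 0 ×ˢ Set.Icc 0 T))
    (hux : ∀ t ∈ Set.Ioo (0:ℝ) T, ∀ x ∈ Set.Ioi (0:ℝ),
      HasDerivAt (fun y => u y t) (ux x t) x)
    (huxx : ∀ t ∈ Set.Ioo (0:ℝ) T, ∀ x ∈ Set.Ioi (0:ℝ),
      HasDerivAt (fun y => ux y t) (uxx x t) x)
    (hut : ∀ t ∈ Set.Ioo (0:ℝ) T, ∀ x ∈ Set.Ioi (0:ℝ),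
      HasDerivAt (fun s => u x s) (ut x t) t)
    (hheat : ∀ t ∈ Set.Ioo (0:ℝ) T, ∀ x ∈ Set.Ioi (0:ℝ), ut x t = uxx x t)
    (hu_int : ∀ t ∈ Set.Ioo (0:ℝ) T, IntegrableOn (fun x => u x t) (Set.Ioi 0))
    (hux_int : ∀ t ∈ Set.Ioo (0:ℝ) T, IntegrableOn (fun x => ux x t) (Set.Ioi 0))
    (huxx_int : ∀ t ∈ Set.Ioo (0:ℝ) T, IntegrableOn (fun x => uxx x t) (Set.Ioi 0))
    (hut_int : ∀ t ∈ Set.Ioo (0:ℝ) T, IntegrableOn (fun x => ut x t) (Set.Ioi 0))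
    (hu_decay : ∀ t ∈ Set.Ioo (0:ℝ) T, Tendsto (fun x => u x t) atTop (nhds 0))
    (hux_decay : ∀ t ∈ Set.Ioo (0:ℝ) T, Tendsto (fun x => ux x t) atTop (nhds 0))
    (hux_trace : ∀ t ∈ Set.Ioo (0:ℝ) T, ContinuousOn (fun x => ux x t) (Set.Ici 0))
    (hdom : ∃ φ : ℝ → ℝ, IntegrableOn φ (Set.Ioi 0) ∧
      ∀ t₀ ∈ Set.Ioo (0:ℝ) T, ∀ᶠ t in nhdsWithin t₀ (Set.Ioo 0 T),
        ∀ x ∈ Set.Ioi (0:ℝ), ‖ut x t‖ ≤ φ x) :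
    ∀ l : ℂ, l.im ≤ 0 → ∀ t ∈ Set.Ioo (0:ℝ) T,
      HasDerivAt (fun s => halfFourier (fun x => u x s) l)
        (-(l ^ 2) * halfFourier (fun x => u x t) l - ux 0 t - Complex.I * l * u 0 t) t := by
  intro l hl t ht
  obtain ⟨φ, hφ, hdom⟩ := hdom
  have hnhds : Set.Ioo 0 T ∈ nhds t := isOpen_Ioo.mem_nhds ht
  have hdom_t := hdom t ht
  rw [nhdsWithin_eq_nhds.2 hnhds] at hdom_t
  have hderiv := (hasDerivAt_integral_of_dominated_loc_of_deriv_le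
    (μ := volume.restrict (Set.Ioi (0:ℝ))) (bound := φ)
    (F := fun s x => Complex.exp (-Complex.I * l * (x : ℂ)) * u x s)
    (F' := fun s x => Complex.exp (-Complex.I * l * (x : ℂ)) * ut x s)
    (Filter.inter_mem hdom_t hnhds)
    (by
      filter_upwards [hnhds] with s hs
      exact (integrableOn_exp_neg_I_mul (hu_int s hs) hl).aestronglyMeasurable)
    (integrableOn_exp_neg_I_mul (hu_int t ht) hl)
    (integrableOn_exp_neg_I_mul (hut_int t ht) hl).aestronglyMeasurable
    (by
      filter_upwards [ae_restrict_mem measurableSet_Ioi] with x hx s hs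
      rw [norm_mul]
      exact (mul_le_of_le_one_left (norm_nonneg _)
        (norm_exp_neg_I_mul_le_one hl (le_of_lt hx))).trans (hs.1 x hx))
    hφ
    (by
      filter_upwards [ae_restrict_mem measurableSet_Ioi] with x hx s hs
      exact (hut s hs.2 x hx).const_mul _)).2
  refine hderiv.congr_deriv ?_
  rw [← halfFourier_second_deriv (hux t ht) (huxx t ht) ?_
    (hux_trace t ht 0 Set.self_mem_Ici) (hu_int t ht) (huxx_int t ht) (hu_decay t ht)
    (hux_decay t ht) hl]
  · exact setIntegral_congr_fun measurableSet_Ioi fun x hx => by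
      simp only [hheat t ht x hx]
  · exact (hu_cont (0, t) ⟨Set.self_mem_Ici, Set.Ioo_subset_Icc_self ht⟩).comp
      (f := fun x : ℝ => (x, t)) (by fun_prop)
      (fun x hx => ⟨hx, Set.Ioo_subset_Icc_self ht⟩)
end

section
/- (Global relation on the finite interval) Let L > 0, T > 0, and let u : [0,L] × [0,T] → ℂ be continuous, twice continuously differentiable in x and once in t on (0,L) × (0,T), satisfy the heat equation u_t = u_xx there, and be such that u_x extends continuously to [0,L] × (0,T). Assume u(0,t) = 0 for all t ∈ [0,T], and set u₀(x) = u(x,0), h(t) = u(L,t), g₁(t) = u_x(0,t), h₁(t) = u_x(L,t), all assumed continuous on [0,T]. If u(x,T) = 0 for all x ∈ [0,L], then for every λ ∈ ℂ: 0 = û₀(λ) + iλ e^{−iλL} ∫₀ᵀ e^{λ²s} h(s) ds − ∫₀ᵀ e^{λ²s} g₁(s) ds + e^{−iλL} ∫₀ᵀ e^{λ²s} h₁(s) ds. -/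
open MeasureTheory

/-- The finite-interval Fourier transform `f̂(λ) = ∫₀^L e^{-iλx} f(x) dx`. -/
noncomputable def intervalFourier (L : ℝ) (f : ℝ → ℂ) (l : ℂ) : ℂ :=
  ∫ x in (0:ℝ)..L, Complex.exp (-Complex.I * l * (x : ℂ)) * f x

/-- `v` solves the heat equation `v_t = v_xx` pointwise on `I ×ˢ J`, where `vx`, `vxx` are its
first and second `x`-derivatives. No continuity of `vxx` is required. -/
structure IsPointwiseHeatOn {E : Type*} [NormedAddCommGroup E] [NormedSpace ℝ E]
    (v vx vxx : ℝ → ℝ → E) (I J : Set ℝ) : Prop where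
  hasDerivAt_x : ∀ t ∈ J, ∀ x ∈ I, HasDerivAt (fun y => v y t) (vx x t) x
  hasDerivAt_xx : ∀ t ∈ J, ∀ x ∈ I, HasDerivAt (fun y => vx y t) (vxx x t) x
  hasDerivAt_t : ∀ t ∈ J, ∀ x ∈ I, HasDerivAt (fun s => v x s) (vxx x t) t

theorem IsPointwiseHeatOn.clm_comp {E F : Type*} [NormedAddCommGroup E] [NormedSpace ℝ E]
    [NormedAddCommGroup F] [NormedSpace ℝ F] {v vx vxx : ℝ → ℝ → E} {I J : Set ℝ}
    (hv : IsPointwiseHeatOn v vx vxx I J) (φ : E →L[ℝ] F) :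
    IsPointwiseHeatOn (fun x t => φ (v x t)) (fun x t => φ (vx x t))
      (fun x t => φ (vxx x t)) I J where
  hasDerivAt_x t ht x hx := φ.hasFDerivAt.comp_hasDerivAt x (hv.hasDerivAt_x t ht x hx)
  hasDerivAt_xx t ht x hx := φ.hasFDerivAt.comp_hasDerivAt x (hv.hasDerivAt_xx t ht x hx)
  hasDerivAt_t t ht x hx := φ.hasFDerivAt.comp_hasDerivAt t (hv.hasDerivAt_t t ht x hx)

/-- A function with a second derivative at a local maximum has nonpositive second derivative
there. -/
theorem IsLocalMax.hasDerivAt_deriv_nonpos {f f' : ℝ → ℝ} {c x : ℝ} (hmax : IsLocalMax f x)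
    (hf : ∀ᶠ y in nhds x, HasDerivAt f (f' y) y) (hf' : HasDerivAt f' c x) : c ≤ 0 := by
  by_contra! hc
  have hd : deriv f =ᶠ[nhds x] f' := hf.mono fun y hy => hy.deriv
  have hdd : deriv (deriv f) x = c := by rw [hd.deriv_eq, hf'.deriv]
  have hmin : IsLocalMin f x :=
    isLocalMin_of_deriv_deriv_pos (by rwa [hdd]) hmax.deriv_eq_zero
      hf.self_of_nhds.continuousAt
  have hconst : f =ᶠ[nhds x] fun _ => f x := by
    filter_upwards [hmin, hmax] with y h1 h2 using le_antisymm h2 h1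
  have h0 : deriv f =ᶠ[nhds x] fun _ => 0 := by
    have := hconst.deriv
    simpa using this
  have : deriv (deriv f) x = 0 := by rw [h0.deriv_eq]; simp
  linarith

set_option maxHeartbeats 1000000 in
/-- Comparison principle: if `W` is a uniform limit of pointwise solutions of the heat equation and
`∂ₜ W (x, 0) = g x` locally uniformly, then `W (·, 0)` lies below any `G` with `G'' = g` that
dominates it at the endpoints. -/
theorem le_of_approx_heat {a b τ : ℝ} (hab : a < b) (hτ : 0 < τ) {W : ℝ → ℝ → ℝ}
    {G G' g : ℝ → ℝ} (hG : ContinuousOn G (Set.Icc a b))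
    (hG1 : ∀ x ∈ Set.Ioo a b, HasDerivAt G (G' x) x)
    (hG2 : ∀ x ∈ Set.Ioo a b, HasDerivAt G' (g x) x)
    (hg : ContinuousOn g (Set.Icc a b))
    (hW : ContinuousOn (fun x => W x 0) (Set.Icc a b))
    (happrox : ∀ ε > 0, ∃ S Sx Sxx : ℝ → ℝ → ℝ,
      IsPointwiseHeatOn S Sx Sxx (Set.Ioo a b) (Set.Ioo (-τ) τ) ∧
      ContinuousOn (fun p : ℝ × ℝ => S p.1 p.2) (Set.Icc a b ×ˢ Set.Icc (-τ) τ) ∧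
      ∀ x ∈ Set.Icc a b, ∀ t ∈ Set.Icc (-τ) τ, |S x t - W x t| ≤ ε)
    (hWt : ∀ η > 0, ∃ σ > 0, ∀ x ∈ Set.Icc a b, ∀ t₁ ∈ Set.Icc (-σ) σ, ∀ t₂ ∈ Set.Icc (-σ) σ,
      |W x t₁ - W x t₂ - g x * (t₁ - t₂)| ≤ η * |t₁ - t₂|)
    (ha : W a 0 ≤ G a) (hb : W b 0 ≤ G b) {y : ℝ} (hy : y ∈ Set.Icc a b) :
    W y 0 ≤ G y := by
  by_contra! hlt
  obtain ⟨η, hη, hηm⟩ : ∃ η > 0, 0 < W y 0 - G y + η * ((y - a) * (y - b)) := by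
    have h2 : 0 < (W y 0 - G y) / (2 * (b - a) ^ 2) := by
      have := sub_pos.2 hlt
      have := sub_pos.2 hab
      positivity
    refine ⟨(W y 0 - G y) / (2 * (b - a) ^ 2), h2, ?_⟩
    have h1 : -(b - a) ^ 2 ≤ (y - a) * (y - b) := by nlinarith [hy.1, hy.2]
    have h3 : (W y 0 - G y) / (2 * (b - a) ^ 2) * (b - a) ^ 2 = (W y 0 - G y) / 2 := by
      have := (sub_pos.2 hab).ne'
      field_simp
    nlinarith [mul_le_mul_of_nonneg_left h1 h2.le]
  set m := W y 0 - G y + η * ((y - a) * (y - b)) with hm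
  obtain ⟨M, hM⟩ := isCompact_Icc.exists_bound_of_continuousOn hg
  obtain ⟨C, hC⟩ := isCompact_Icc.exists_bound_of_continuousOn (hW.sub hG)
  have hM0 : 0 ≤ M := (norm_nonneg _).trans (hM y hy)
  have hC0 : 0 ≤ C := (norm_nonneg _).trans (hC y hy)
  obtain ⟨σ₀, hσ₀, hWσ⟩ := hWt (η / 4) (by positivity)
  obtain ⟨σ, hσ, hσ1, hσ2, hσ3⟩ : ∃ σ > 0, σ ≤ σ₀ ∧ σ ≤ τ ∧ (M + η) * σ ≤ m / 4 := by
    refine ⟨min σ₀ (min τ (m / 4 / (M + η))), by positivity, min_le_left _ _,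
      (min_le_right _ _).trans (min_le_left _ _), ?_⟩
    rw [mul_comm, ← le_div_iff₀ (by positivity)]
    exact (min_le_right _ _).trans (min_le_right _ _)
  obtain ⟨N, hN, hN1, hN2⟩ : ∃ N > 0, C + m ≤ N * σ ^ 2 ∧ M ≤ 2 * N * σ := by
    refine ⟨max ((C + m) / σ ^ 2) (M / (2 * σ)), lt_max_of_lt_left (by positivity), ?_, ?_⟩
    · rw [← div_le_iff₀ (by positivity)]; exact le_max_left _ _
    · have := le_max_right ((C + m) / σ ^ 2) (M / (2 * σ))
      rw [div_le_iff₀ (by positivity)] at this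
      linarith
  obtain ⟨S, Sx, Sxx, hS, hSc, hSW⟩ := happrox (min (m / 8) (η ^ 2 / (4 * N))) (by positivity)
  set ε := min (m / 8) (η ^ 2 / (4 * N))
  have hε1 : ε ≤ m / 8 := min_le_left _ _
  have hε2 : ε * (4 * N) ≤ η ^ 2 := by
    rw [← le_div_iff₀ (by positivity)]; exact min_le_right _ _
  have hsub : Set.Icc (-σ) σ ⊆ Set.Icc (-τ) τ := Set.Icc_subset_Icc (by linarith) hσ2
  have hsub0 : Set.Icc (-σ) σ ⊆ Set.Icc (-σ₀) σ₀ := Set.Icc_subset_Icc (by linarith) hσ1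
  set F : ℝ × ℝ → ℝ :=
    fun p => S p.1 p.2 - G p.1 + η * ((p.1 - a) * (p.1 - b)) - N * p.2 ^ 2 with hF
  have hFc : ContinuousOn F (Set.Icc a b ×ˢ Set.Icc (-σ) σ) := by
    have h1 := hSc.mono (Set.prod_mono_right (s := Set.Icc a b) hsub)
    have h2 : ContinuousOn (fun p : ℝ × ℝ => G p.1) (Set.Icc a b ×ˢ Set.Icc (-σ) σ) :=
      hG.comp continuousOn_fst fun p hp => hp.1
    exact ((h1.sub h2).add (by fun_prop)).sub (by fun_prop)
  have h0 : (0:ℝ) ∈ Set.Icc (-σ) σ := ⟨by linarith, hσ.le⟩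
  obtain ⟨⟨x, t⟩, ⟨hx, ht⟩, hmax⟩ :=
    (isCompact_Icc.prod isCompact_Icc).exists_isMaxOn ⟨(y, 0), hy, h0⟩ hFc
  simp only at hx ht
  have hFy : m - ε ≤ F (x, t) := by
    refine le_trans ?_ (hmax (Set.mk_mem_prod hy h0))
    have := (abs_le.1 (hSW y hy 0 (hsub h0))).1
    simp only [hF, hm]; linarith
  have hSx := abs_le.1 (hSW x hx t (hsub ht))
  have hgx := abs_le.1 (hM x hx)
  have htσ : |t| ≤ σ := abs_le.2 ht
  have hWx : W x t ≤ W x 0 + m / 4 := by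
    have h1 := (abs_le.1 (hWσ x hx t (hsub0 ht) 0 (hsub0 h0))).2
    have h2 : g x * t ≤ M * |t| := by
      calc g x * t ≤ |g x * t| := le_abs_self _
        _ = |g x| * |t| := abs_mul _ _
        _ ≤ _ := by gcongr; exact hM x hx
    have h3 : M * |t| ≤ M * σ := by gcongr
    have h4 : η / 4 * |t| ≤ η * σ := by nlinarith [abs_nonneg t]
    simp only [sub_zero] at h1
    linarith
  have hFx : F (x, t) ≤ W x 0 - G x + m / 4 + ε + η * ((x - a) * (x - b)) - N * t ^ 2 := by
    simp only [hF]; linarith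
  have hq : η * ((x - a) * (x - b)) ≤ 0 := by
    apply mul_nonpos_of_nonneg_of_nonpos hη.le
    nlinarith [hx.1, hx.2]
  have hNt : 0 ≤ N * t ^ 2 := by positivity
  have hxa : x ≠ a := by rintro rfl; linarith
  have hxb : x ≠ b := by rintro rfl; linarith
  have hKx : W x 0 - G x ≤ C := (le_abs_self _).trans (hC x hx)
  have htne : t ^ 2 ≠ σ ^ 2 := by intro h; rw [h] at hFx; linarith
  have hx' : x ∈ Set.Ioo a b := ⟨lt_of_le_of_ne hx.1 hxa.symm, lt_of_le_of_ne hx.2 hxb⟩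
  have ht' : t ∈ Set.Ioo (-σ) σ := by
    refine ⟨lt_of_le_of_ne ht.1 ?_, lt_of_le_of_ne ht.2 ?_⟩
    · rintro h; apply htne; rw [← h]; ring
    · rintro rfl; exact htne rfl
  have htτ : t ∈ Set.Ioo (-τ) τ := ⟨by linarith [ht'.1], by linarith [ht'.2]⟩
  have hSt : Sxx x t = 2 * N * t := by
    have hloc : IsLocalMax (fun s => F (x, s)) t := by
      filter_upwards [Icc_mem_nhds ht'.1 ht'.2] with s hs using hmax (Set.mk_mem_prod hx hs)
    have hd : HasDerivAt (fun s => F (x, s)) (Sxx x t - N * (2 * t)) t := by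
      have h1 := (((hS.hasDerivAt_t t htτ x hx').sub_const (G x)).add_const
        (η * ((x - a) * (x - b)))).sub (((hasDerivAt_id t).pow 2).const_mul N)
      refine h1.congr_deriv ?_
      simp
    have := hloc.hasDerivAt_eq_zero hd
    linarith
  have hSxx : Sxx x t - g x + 2 * η ≤ 0 := by
    have hloc : IsLocalMax (fun z => F (z, t)) x := by
      filter_upwards [Icc_mem_nhds hx'.1 hx'.2] with z hz using hmax (Set.mk_mem_prod hz ht)
    refine hloc.hasDerivAt_deriv_nonpos (f' := fun z => Sx z t - G' z + η * (2 * z - a - b)) ?_ ?_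
    · filter_upwards [Ioo_mem_nhds hx'.1 hx'.2] with z hz
      have h1 := (((hS.hasDerivAt_x t htτ z hz).sub (hG1 z hz)).add
        ((((hasDerivAt_id z).sub_const a).mul ((hasDerivAt_id z).sub_const b)).const_mul
          η)).sub_const (N * t ^ 2)
      refine h1.congr_deriv ?_
      simp only [id]; ring
    · have h1 := ((hS.hasDerivAt_xx t htτ x hx').sub (hG2 x hx')).add
        (((((hasDerivAt_id x).const_mul 2).sub_const a).sub_const b).const_mul η)
      refine h1.congr_deriv ?_
      ring
  set t₀ := g x / (2 * N) with ht₀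
  have hgt : g x = 2 * N * t₀ := by rw [ht₀]; field_simp
  have ht₀m : t₀ ∈ Set.Icc (-σ) σ := by
    constructor
    · rw [ht₀, le_div_iff₀ (by positivity)]; linarith
    · rw [ht₀, div_le_iff₀ (by positivity)]; linarith
  have hcmp : F (x, t₀) ≤ F (x, t) := hmax (Set.mk_mem_prod hx ht₀m)
  have hs : η ≤ N * (t₀ - t) := by rw [hSt, hgt] at hSxx; linarith
  have hspos : 0 < t₀ - t := by
    by_contra! h
    nlinarith
  have hS0 := abs_le.1 (hSW x hx t₀ (hsub ht₀m))
  have hWd := (abs_le.1 (hWσ x hx t (hsub0 ht) t₀ (hsub0 ht₀m))).2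
  rw [abs_sub_comm, abs_of_pos hspos, hgt] at hWd
  simp only [hF] at hcmp
  have key : N * (t₀ - t) ^ 2 ≤ η / 4 * (t₀ - t) + 2 * ε := by nlinarith
  have k2 : (N * (t₀ - t)) ^ 2 ≤ η / 4 * (N * (t₀ - t)) + 2 * ε * N := by
    have := mul_le_mul_of_nonneg_left key hN.le
    nlinarith
  nlinarith

section IntervalIntegrals

variable {E : Type*} [NormedAddCommGroup E] [NormedSpace ℝ E]

theorem ContinuousOn.intervalIntegral_param {f : ℝ → ℝ → E} {a b c d : ℝ} (hab : a ≤ b)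
    (hcd : c ≤ d)
    (hf : ContinuousOn (fun p : ℝ × ℝ => f p.1 p.2) (Set.Icc a b ×ˢ Set.Icc c d)) :
    ContinuousOn (fun x => ∫ s in c..d, f x s) (Set.Icc a b) := by
  have hcont : Continuous (Function.uncurry fun x s : ℝ =>
      f (Set.projIcc a b hab x) (Set.projIcc c d hcd s)) := by
    refine hf.comp_continuous (f := fun p : ℝ × ℝ =>
      ((Set.projIcc a b hab p.1 : ℝ), (Set.projIcc c d hcd p.2 : ℝ))) ?_ ?_
    · exact (continuous_subtype_val.comp (continuous_projIcc.comp continuous_fst)).prodMk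
        (continuous_subtype_val.comp (continuous_projIcc.comp continuous_snd))
    · exact fun p => ⟨Subtype.coe_prop _, Subtype.coe_prop _⟩
  refine (intervalIntegral.continuous_parametric_intervalIntegral_of_continuous'
    (μ := volume) hcont c d).continuousOn.congr fun x hx => ?_
  refine intervalIntegral.integral_congr fun s hs => ?_
  rw [Set.uIcc_of_le hcd] at hs
  simp only [Set.projIcc_of_mem hab hx, Set.projIcc_of_mem hcd hs]

theorem intervalIntegral_swap_of_continuousOn {f : ℝ → ℝ → E} {a b c d : ℝ} (hab : a ≤ b)
    (hcd : c ≤ d)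
    (hf : ContinuousOn (fun p : ℝ × ℝ => f p.1 p.2) (Set.Icc a b ×ˢ Set.Icc c d)) :
    ∫ x in a..b, ∫ s in c..d, f x s = ∫ s in c..d, ∫ x in a..b, f x s := by
  simp only [intervalIntegral.integral_of_le hcd]
  rw [intervalIntegral_integral_swap]
  rw [Set.uIoc_of_le hab, Measure.prod_restrict]
  exact (hf.integrableOn_compact (isCompact_Icc.prod isCompact_Icc)).mono_set
    (Set.prod_mono Set.Ioc_subset_Icc_self Set.Ioc_subset_Icc_self)

theorem hasDerivAt_intervalIntegral_of_continuousOn [CompleteSpace E] {f : ℝ → E} {a b x : ℝ}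
    (hf : ContinuousOn f (Set.Icc a b)) (hx : x ∈ Set.Ioo a b) :
    HasDerivAt (fun y => ∫ s in a..y, f s) (f x) x := by
  refine intervalIntegral.integral_hasDerivAt_right ?_ ?_
    (hf.continuousAt (Icc_mem_nhds hx.1 hx.2))
  · refine (hf.mono ?_).intervalIntegrable
    rw [Set.uIcc_of_le hx.1.le]
    exact Set.Icc_subset_Icc_right hx.2.le
  · exact (hf.mono Set.Ioo_subset_Icc_self).stronglyMeasurableAtFilter isOpen_Ioo x hx

theorem ContinuousOn.intervalIntegral_primitive {f : ℝ → E} {a b : ℝ} (hab : a ≤ b)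
    (hf : ContinuousOn f (Set.Icc a b)) :
    ContinuousOn (fun y => ∫ s in a..y, f s) (Set.Icc a b) := by
  have := intervalIntegral.continuousOn_primitive_interval (μ := volume) (f := f) (a := a) (b := b)
    (by rw [Set.uIcc_of_le hab]; exact hf.integrableOn_compact isCompact_Icc)
  rwa [Set.uIcc_of_le hab] at this

/-- Error bound for left Riemann sums with `n` equal steps. -/
theorem norm_riemannSum_sub_integral_le [CompleteSpace E] {f : ℝ → E} {c d ε : ℝ} {n : ℕ}
    (hn : 0 < n) (hcd : c ≤ d) (hf : ContinuousOn f (Set.Icc c d))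
    (hε : ∀ s ∈ Set.Icc c d, ∀ s' ∈ Set.Icc c d, |s - s'| ≤ (d - c) / n → ‖f s - f s'‖ ≤ ε) :
    ‖(∑ k ∈ Finset.range n, ((d - c) / n) • f (c + k * ((d - c) / n))) - ∫ s in c..d, f s‖
      ≤ ε * (d - c) := by
  set δ := (d - c) / n with hδ
  have hn' : (0:ℝ) < n := by exact_mod_cast hn
  have hnδ : n * δ = d - c := by rw [hδ]; field_simp
  have hδ0 : 0 ≤ δ := div_nonneg (sub_nonneg.2 hcd) hn'.le
  have hnode : ∀ k ≤ n, c + (k:ℝ) * δ ∈ Set.Icc c d := by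
    intro k hk
    have h1 : (k:ℝ) ≤ n := by exact_mod_cast hk
    have h2 := mul_le_mul_of_nonneg_right h1 hδ0
    exact ⟨by nlinarith [(Nat.cast_nonneg k : (0:ℝ) ≤ k)], by linarith⟩
  have hstep : ∀ k : ℕ, c + ((k + 1 : ℕ):ℝ) * δ = c + (k:ℝ) * δ + δ := by
    intro k; push_cast; ring
  have hsub : ∀ k < n, Set.Icc (c + (k:ℝ) * δ) (c + ((k + 1 : ℕ):ℝ) * δ) ⊆ Set.Icc c d :=
    fun k hk => Set.Icc_subset_Icc (hnode k hk.le).1 (hnode (k + 1) hk).2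
  have hint : ∀ k < n, IntervalIntegrable f volume (c + (k:ℝ) * δ) (c + ((k + 1 : ℕ):ℝ) * δ) := by
    intro k hk
    refine (hf.mono ?_).intervalIntegrable
    rw [Set.uIcc_of_le (by rw [hstep]; linarith)]
    exact hsub k hk
  have hsum := intervalIntegral.sum_integral_adjacent_intervals (μ := volume) (f := f)
    (a := fun k : ℕ => c + (k:ℝ) * δ) (n := n) hint
  simp only [Nat.cast_zero, zero_mul, add_zero, hnδ, add_sub_cancel] at hsum
  rw [← hsum, ← Finset.sum_sub_distrib]
  have hle : ∀ k ∈ Finset.range n, ‖δ • f (c + k * δ) -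
      ∫ s in (c + (k:ℝ) * δ)..(c + ((k + 1 : ℕ):ℝ) * δ), f s‖ ≤ ε * δ := by
    intro k hk
    have hk := Finset.mem_range.1 hk
    have hconst : δ • f (c + k * δ) =
        ∫ s in (c + (k:ℝ) * δ)..(c + ((k + 1 : ℕ):ℝ) * δ), f (c + k * δ) := by
      rw [intervalIntegral.integral_const, hstep]; simp
    rw [hconst, ← intervalIntegral.integral_sub intervalIntegrable_const (hint k hk)]
    have := intervalIntegral.norm_integral_le_of_norm_le_const
      (a := c + (k:ℝ) * δ) (b := c + ((k + 1 : ℕ):ℝ) * δ) (C := ε)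
      (f := fun s => f (c + k * δ) - f s) ?_
    · rwa [show c + ((k + 1 : ℕ):ℝ) * δ - (c + (k:ℝ) * δ) = δ by rw [hstep]; ring,
        abs_of_nonneg hδ0] at this
    · intro s hs
      have hle : c + (k:ℝ) * δ ≤ c + ((k + 1 : ℕ):ℝ) * δ := by rw [hstep]; linarith
      rw [Set.uIoc_of_le hle] at hs
      refine hε _ (hnode k hk.le) _ (hsub k hk (Set.Ioc_subset_Icc_self hs)) ?_
      rw [hstep] at hs
      rw [abs_sub_comm, abs_of_nonneg] <;> linarith [hs.1, hs.2]
  refine (norm_sum_le_of_le _ hle).trans ?_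
  rw [Finset.sum_const, Finset.card_range, nsmul_eq_mul]
  have : (n:ℝ) * (ε * δ) = ε * (n * δ) := by ring
  rw [this, hnδ]

end IntervalIntegrals

theorem IsPointwiseHeatOn.neg {v vx vxx : ℝ → ℝ → ℝ} {I J : Set ℝ}
    (hv : IsPointwiseHeatOn v vx vxx I J) :
    IsPointwiseHeatOn (fun x t => -v x t) (fun x t => -vx x t) (fun x t => -vxx x t) I J where
  hasDerivAt_x t ht x hx := (hv.hasDerivAt_x t ht x hx).neg
  hasDerivAt_xx t ht x hx := (hv.hasDerivAt_xx t ht x hx).neg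
  hasDerivAt_t t ht x hx := (hv.hasDerivAt_t t ht x hx).neg

theorem IsPointwiseHeatOn.sum_translate {ι : Type*} (A : Finset ι) (w s : ι → ℝ)
    {v vx vxx : ℝ → ℝ → ℝ} {I I' J J' : Set ℝ} (hv : IsPointwiseHeatOn v vx vxx I J)
    (hI : I' ⊆ I) (hs : ∀ k ∈ A, ∀ t ∈ J', s k + t ∈ J) :
    IsPointwiseHeatOn (fun x t => ∑ k ∈ A, w k * v x (s k + t))
      (fun x t => ∑ k ∈ A, w k * vx x (s k + t))
      (fun x t => ∑ k ∈ A, w k * vxx x (s k + t)) I' J' where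
  hasDerivAt_x t ht x hx := HasDerivAt.fun_sum fun k hk =>
    (hv.hasDerivAt_x _ (hs k hk t ht) x (hI hx)).const_mul (w k)
  hasDerivAt_xx t ht x hx := HasDerivAt.fun_sum fun k hk =>
    (hv.hasDerivAt_xx _ (hs k hk t ht) x (hI hx)).const_mul (w k)
  hasDerivAt_t t ht x hx := HasDerivAt.fun_sum fun k hk =>
    ((hv.hasDerivAt_t _ (hs k hk t ht) x (hI hx)).comp_const_add (s k) t).const_mul (w k)

set_option maxHeartbeats 1000000 in
/-- Comparison of the time average of a pointwise solution of the heat equation with a function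
whose second derivative is the increment of the solution. -/
theorem IsPointwiseHeatOn.integral_le {L T : ℝ} {v vx vxx : ℝ → ℝ → ℝ}
    (hv : IsPointwiseHeatOn v vx vxx (Set.Ioo 0 L) (Set.Ioo 0 T))
    (hvc : ContinuousOn (fun p : ℝ × ℝ => v p.1 p.2) (Set.Ioo 0 L ×ˢ Set.Ioo 0 T))
    {a b c d : ℝ} (h0a : 0 < a) (hab : a < b) (hbL : b < L) (h0c : 0 < c) (hcd : c < d)
    (hdT : d < T) {G G' : ℝ → ℝ} (hG : ContinuousOn G (Set.Icc a b))
    (hG1 : ∀ x ∈ Set.Ioo a b, HasDerivAt G (G' x) x)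
    (hG2 : ∀ x ∈ Set.Ioo a b, HasDerivAt G' (v x d - v x c) x)
    (ha : ∫ s in c..d, v a s ≤ G a) (hb : ∫ s in c..d, v b s ≤ G b)
    {y : ℝ} (hy : y ∈ Set.Icc a b) : ∫ s in c..d, v y s ≤ G y := by
  obtain ⟨τ, hτ, hτc, hτd⟩ : ∃ τ > 0, τ < c ∧ d + τ < T := by
    refine ⟨min c (T - d) / 2, ?_, ?_, ?_⟩
    · have : 0 < min c (T - d) := lt_min h0c (by linarith)
      linarith
    · have := min_le_left c (T - d); linarith
    · have := min_le_right c (T - d); linarith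
  have hboxsub : Set.Icc a b ×ˢ Set.Icc (c - τ) (d + τ) ⊆ Set.Ioo 0 L ×ˢ Set.Ioo 0 T :=
    Set.prod_mono (Set.Icc_subset_Ioo h0a hbL) (Set.Icc_subset_Ioo (by linarith) hτd)
  have hvK : ContinuousOn (fun p : ℝ × ℝ => v p.1 p.2)
      (Set.Icc a b ×ˢ Set.Icc (c - τ) (d + τ)) := hvc.mono hboxsub
  have hvt : ∀ x ∈ Set.Icc a b, ContinuousOn (fun s => v x s) (Set.Icc (c - τ) (d + τ)) :=
    fun x hx => hvK.comp (f := fun s : ℝ => (x, s)) (by fun_prop) fun s hs => ⟨hx, hs⟩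
  have hvx : ∀ s ∈ Set.Icc (c - τ) (d + τ), ContinuousOn (fun x => v x s) (Set.Icc a b) :=
    fun s hs => hvK.comp (f := fun x : ℝ => (x, s)) (by fun_prop) fun x hx => ⟨hx, hs⟩
  have hunif : ∀ ε > 0, ∃ δ > 0, ∀ x ∈ Set.Icc a b, ∀ s ∈ Set.Icc (c - τ) (d + τ),
      ∀ s' ∈ Set.Icc (c - τ) (d + τ), |s - s'| < δ → |v x s - v x s'| ≤ ε := by
    intro ε hε
    obtain ⟨δ, hδ, H⟩ := Metric.uniformContinuousOn_iff.1
      ((isCompact_Icc.prod isCompact_Icc).uniformContinuousOn_of_continuous hvK) ε hε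
    refine ⟨δ, hδ, fun x hx s hs s' hs' hss => ?_⟩
    have := H (x, s) ⟨hx, hs⟩ (x, s') ⟨hx, hs'⟩ (by
      simpa [Prod.dist_eq, Real.dist_eq] using hss)
    exact (Real.dist_eq _ _ ▸ this).le
  have hii : ∀ x ∈ Set.Icc a b, ∀ s ∈ Set.Icc (c - τ) (d + τ), ∀ s' ∈ Set.Icc (c - τ) (d + τ),
      IntervalIntegrable (fun s => v x s) volume s s' := fun x hx s hs s' hs' =>
    ((hvt x hx).mono (Set.uIcc_subset_Icc hs hs')).intervalIntegrable
  have key := le_of_approx_heat (W := fun x t => ∫ s in c..d, v x (s + t)) hab hτ hG hG1 hG2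
    ((hvx d ⟨by linarith, by linarith⟩).sub (hvx c ⟨by linarith, by linarith⟩)) ?_ ?_ ?_
    (by simpa using ha) (by simpa using hb) hy
  · simpa using key
  · simp only [add_zero]
    exact ContinuousOn.intervalIntegral_param hab.le hcd.le (hvK.mono
      (Set.prod_mono_right (Set.Icc_subset_Icc (by linarith) (by linarith))))
  · intro ε hε
    have hcd' : 0 < d - c := sub_pos.2 hcd
    obtain ⟨δ, hδ, hδv⟩ := hunif (ε / (d - c)) (by positivity)
    obtain ⟨n, hn⟩ := exists_nat_gt ((d - c) / δ)
    have hn0 : (0:ℝ) < n := lt_trans (by positivity) hn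
    have hnδ : (d - c) / n < δ := by
      rw [div_lt_iff₀ hδ] at hn
      rw [div_lt_iff₀ hn0]; linarith
    have hnode : ∀ k ∈ Finset.range n, c + (k:ℝ) * ((d - c) / n) ∈ Set.Icc c d := by
      intro k hk
      have h1 : (k:ℝ) ≤ n := by exact_mod_cast (Finset.mem_range.1 hk).le
      have h2 : 0 ≤ (k:ℝ) * ((d - c) / n) := by positivity
      have h3 : (n:ℝ) * ((d - c) / n) = d - c := by field_simp
      have h4 := mul_le_mul_of_nonneg_right h1 (by positivity : 0 ≤ (d - c) / n)
      exact ⟨by linarith, by linarith⟩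
    refine ⟨_, _, _, hv.sum_translate (Finset.range n) (fun _ => (d - c) / n)
      (fun k => c + k * ((d - c) / n)) (Set.Ioo_subset_Ioo h0a.le hbL.le) ?_, ?_, ?_⟩
    · intro k hk t ht
      have := hnode k hk
      exact ⟨by linarith [this.1, ht.1], by linarith [this.2, ht.2]⟩
    · refine continuousOn_finsetSum _ fun k hk => continuousOn_const.mul ?_
      refine hvK.comp (f := fun p : ℝ × ℝ => (p.1, c + k * ((d - c) / n) + p.2))
        (by fun_prop) fun p hp => ⟨hp.1, ?_⟩
      have := hnode k hk
      exact ⟨by linarith [this.1, hp.2.1], by linarith [this.2, hp.2.2]⟩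
    · intro x hx t ht
      have hmem : ∀ s ∈ Set.Icc c d, s + t ∈ Set.Icc (c - τ) (d + τ) := fun s hs =>
        ⟨by linarith [hs.1, ht.1], by linarith [hs.2, ht.2]⟩
      have := norm_riemannSum_sub_integral_le (f := fun s => v x (s + t)) (c := c) (d := d)
        (ε := ε / (d - c)) (n := n) (by exact_mod_cast hn0) hcd.le
        ((hvt x hx).comp (by fun_prop) hmem) fun s hs s' hs' hss =>
          hδv x hx _ (hmem s hs) _ (hmem s' hs') (by
            rw [add_sub_add_right_eq_sub]; exact hss.trans_lt hnδ)
      rwa [div_mul_cancel₀ _ hcd'.ne'] at this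
  · intro η hη
    obtain ⟨δ, hδ, hδv⟩ := hunif (η / 2) (by positivity)
    refine ⟨min τ (δ / 2), by positivity, fun x hx t₁ ht₁ t₂ ht₂ => ?_⟩
    have hmτ := min_le_left τ (δ / 2)
    have hmδ := min_le_right τ (δ / 2)
    have hbound : ∀ r ∈ Set.Icc c d,
        |(∫ s in (r + t₂)..(r + t₁), v x s) - v x r * (t₁ - t₂)| ≤ η / 2 * |t₁ - t₂| := by
      intro r hr
      have hmem : ∀ t ∈ Set.Icc (-min τ (δ / 2)) (min τ (δ / 2)),
          r + t ∈ Set.Icc (c - τ) (d + τ) := fun t ht =>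
        ⟨by linarith [hr.1, ht.1], by linarith [hr.2, ht.2]⟩
      have hconst : v x r * (t₁ - t₂) = ∫ s in (r + t₂)..(r + t₁), v x r := by
        rw [intervalIntegral.integral_const, smul_eq_mul]; ring
      rw [hconst, ← intervalIntegral.integral_sub
        (hii x hx _ (hmem t₂ ht₂) _ (hmem t₁ ht₁)) intervalIntegrable_const]
      have := intervalIntegral.norm_integral_le_of_norm_le_const (a := r + t₂) (b := r + t₁)
        (C := η / 2) (f := fun s => v x s - v x r) ?_
      · rwa [add_sub_add_left_eq_sub] at this
      · intro s hs
        have hs' : s - r ∈ Set.Icc (-min τ (δ / 2)) (min τ (δ / 2)) := by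
          have hs2 := Set.uIcc_subset_Icc (a₂ := r + -min τ (δ / 2)) (b₂ := r + min τ (δ / 2))
            ⟨by linarith [ht₂.1], by linarith [ht₂.2]⟩
            ⟨by linarith [ht₁.1], by linarith [ht₁.2]⟩ (Set.uIoc_subset_uIcc hs)
          exact ⟨by linarith [hs2.1], by linarith [hs2.2]⟩
        have hsm := hmem _ hs'
        rw [add_sub_cancel] at hsm
        refine hδv x hx s hsm r ⟨by linarith [hr.1], by linarith [hr.2]⟩ ?_
        exact (abs_le.2 hs').trans_lt (by linarith)
    have hmem : ∀ r ∈ Set.Icc c d, ∀ t ∈ Set.Icc (-min τ (δ / 2)) (min τ (δ / 2)),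
        r + t ∈ Set.Icc (c - τ) (d + τ) := fun r hr t ht =>
      ⟨by linarith [hr.1, ht.1], by linarith [hr.2, ht.2]⟩
    have hc : c ∈ Set.Icc c d := ⟨le_rfl, hcd.le⟩
    have hd : d ∈ Set.Icc c d := ⟨hcd.le, le_rfl⟩
    have hdiff : (∫ s in c..d, v x (s + t₁)) - ∫ s in c..d, v x (s + t₂) =
        (∫ s in (d + t₂)..(d + t₁), v x s) - ∫ s in (c + t₂)..(c + t₁), v x s := by
      rw [intervalIntegral.integral_comp_add_right (fun s => v x s),
        intervalIntegral.integral_comp_add_right (fun s => v x s),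
        intervalIntegral.integral_interval_sub_interval_comm
          (hii x hx _ (hmem c hc t₁ ht₁) _ (hmem d hd t₁ ht₁))
          (hii x hx _ (hmem c hc t₂ ht₂) _ (hmem d hd t₂ ht₂))
          (hii x hx _ (hmem c hc t₁ ht₁) _ (hmem c hc t₂ ht₂)),
        intervalIntegral.integral_symm (c + t₂), intervalIntegral.integral_symm (d + t₂)]
      ring
    rw [hdiff]
    have h1 := abs_le.1 (hbound d hd)
    have h2 := abs_le.1 (hbound c hc)
    rw [abs_le]
    constructor <;> linarith [h1.1, h1.2, h2.1, h2.2]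

theorem IsPointwiseHeatOn.exists_integral_deriv_eq_real {L T : ℝ} {v vx vxx : ℝ → ℝ → ℝ}
    (hv : IsPointwiseHeatOn v vx vxx (Set.Ioo 0 L) (Set.Ioo 0 T))
    (hvc : ContinuousOn (fun p : ℝ × ℝ => v p.1 p.2) (Set.Ioo 0 L ×ˢ Set.Ioo 0 T))
    (hvxc : ContinuousOn (fun p : ℝ × ℝ => vx p.1 p.2) (Set.Ioo 0 L ×ˢ Set.Ioo 0 T))
    {a b c d : ℝ} (h0a : 0 < a) (hab : a < b) (hbL : b < L) (h0c : 0 < c) (hcd : c < d)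
    (hdT : d < T) :
    ∃ β, ∀ x ∈ Set.Ioo a b, ∫ s in c..d, vx x s = (∫ y in a..x, (v y d - v y c)) + β := by
  have hI : Set.Icc a b ⊆ Set.Ioo 0 L := Set.Icc_subset_Ioo h0a hbL
  have hJ : Set.Icc c d ⊆ Set.Ioo 0 T := Set.Icc_subset_Ioo h0c hdT
  have hc : c ∈ Set.Ioo 0 T := hJ ⟨le_rfl, hcd.le⟩
  have hd : d ∈ Set.Ioo 0 T := hJ ⟨hcd.le, le_rfl⟩
  have hgc : ContinuousOn (fun y => v y d - v y c) (Set.Icc a b) :=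
    (hvc.comp (f := fun x : ℝ => (x, d)) (by fun_prop) fun x hx => ⟨hI hx, hd⟩).sub
      (hvc.comp (f := fun x : ℝ => (x, c)) (by fun_prop) fun x hx => ⟨hI hx, hc⟩)
  set H : ℝ → ℝ := fun y => ∫ z in a..y, (v z d - v z c)
  have hHc : ContinuousOn H (Set.Icc a b) := hgc.intervalIntegral_primitive hab.le
  have hHd : ∀ x ∈ Set.Ioo a b, HasDerivAt H (v x d - v x c) x := fun x hx =>
    hasDerivAt_intervalIntegral_of_continuousOn hgc hx
  set W : ℝ → ℝ := fun x => ∫ s in c..d, v x s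
  set G₀ : ℝ → ℝ := fun x => ∫ y in a..x, H y with hG₀
  set β := (W b - W a - G₀ b) / (b - a)
  set G : ℝ → ℝ := fun x => G₀ x + (W a + β * (x - a)) with hGdef
  have hGc : ContinuousOn G (Set.Icc a b) :=
    (hHc.intervalIntegral_primitive hab.le).add (by fun_prop)
  have hGd : ∀ x ∈ Set.Ioo a b, HasDerivAt G (H x + β) x := fun x hx => by
    have h1 := (hasDerivAt_intervalIntegral_of_continuousOn hHc hx).add
      ((((hasDerivAt_id x).sub_const a).const_mul β).const_add (W a))
    exact h1.congr_deriv (by ring)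
  have hGa : G a = W a := by simp [hGdef, hG₀]
  have hGb : G b = W b := by
    have : β * (b - a) = W b - W a - G₀ b := div_mul_cancel₀ _ (sub_pos.2 hab).ne'
    simp only [hGdef, this]; ring
  have hWG : ∀ x ∈ Set.Icc a b, W x = G x := by
    intro x hx
    refine le_antisymm ?_ ?_
    · exact hv.integral_le hvc h0a hab hbL h0c hcd hdT hGc hGd
        (fun x hx => (hHd x hx).add_const β) hGa.ge hGb.ge hx
    · have := hv.neg.integral_le hvc.neg h0a hab hbL h0c hcd hdT hGc.neg
        (fun x hx => (hGd x hx).neg)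
        (fun x hx => (((hHd x hx).add_const β).neg).congr_deriv (by ring))
        (by rw [intervalIntegral.integral_neg]; exact neg_le_neg hGa.le)
        (by rw [intervalIntegral.integral_neg]; exact neg_le_neg hGb.le) hx
      rw [intervalIntegral.integral_neg] at this
      exact neg_le_neg_iff.1 this
  have hJc : ContinuousOn (fun x => ∫ s in c..d, vx x s) (Set.Icc a b) :=
    ContinuousOn.intervalIntegral_param hab.le hcd.le (hvxc.mono (Set.prod_mono hI hJ))
  have hWJ : ∀ x ∈ Set.Icc a b, W x = W a + ∫ y in a..x, ∫ s in c..d, vx y s := by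
    intro x hx
    have hsub : Set.Icc a x ⊆ Set.Ioo 0 L := (Set.Icc_subset_Icc_right hx.2).trans hI
    rw [intervalIntegral_swap_of_continuousOn hx.1 hcd.le (hvxc.mono (Set.prod_mono hsub hJ))]
    have hslice : ∀ y ∈ Set.Icc a b, ContinuousOn (fun s => v y s) (Set.uIcc c d) := fun y hy => by
      rw [Set.uIcc_of_le hcd.le]
      exact hvc.comp (f := fun s : ℝ => (y, s)) (by fun_prop) fun s hs => ⟨hI hy, hJ hs⟩
    have : ∫ s in c..d, ∫ y in a..x, vx y s = ∫ s in c..d, (v x s - v a s) := by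
      refine intervalIntegral.integral_congr fun s hs => ?_
      rw [Set.uIcc_of_le hcd.le] at hs
      refine intervalIntegral.integral_eq_sub_of_hasDerivAt (f := fun y => v y s) ?_ ?_
      · intro y hy
        rw [Set.uIcc_of_le hx.1] at hy
        exact hv.hasDerivAt_x s (hJ hs) y (hsub hy)
      · refine (hvxc.comp (f := fun y : ℝ => (y, s)) (by fun_prop)
          fun y hy => ⟨?_, hJ hs⟩).intervalIntegrable
        rw [Set.uIcc_of_le hx.1] at hy
        exact hsub hy
    rw [this, intervalIntegral.integral_sub (hslice x hx).intervalIntegrable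
      (hslice a ⟨le_rfl, hab.le⟩).intervalIntegrable]
    ring
  refine ⟨β, fun x hx => ?_⟩
  have h1 : HasDerivAt W (∫ s in c..d, vx x s) x := by
    refine ((hasDerivAt_intervalIntegral_of_continuousOn hJc hx).const_add
      (W a)).congr_of_eventuallyEq ?_
    filter_upwards [Icc_mem_nhds hx.1 hx.2] with y hy using hWJ y hy
  refine h1.unique ((hGd x hx).congr_of_eventuallyEq ?_)
  filter_upwards [Icc_mem_nhds hx.1 hx.2] with y hy using hWG y hy

/-- Green's identity on the rectangle `[0, x] × [c, d]` for pointwise solutions of the heat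
equation. -/
theorem IsPointwiseHeatOn.integral_sub_eq_integral_deriv_sub {L T : ℝ} (hL : 0 < L)
    {u ux uxx : ℝ → ℝ → ℂ}
    (hu : IsPointwiseHeatOn u ux uxx (Set.Ioo 0 L) (Set.Ioo 0 T))
    (huc : ContinuousOn (fun p : ℝ × ℝ => u p.1 p.2) (Set.Icc 0 L ×ˢ Set.Icc 0 T))
    (huxc : ContinuousOn (fun p : ℝ × ℝ => ux p.1 p.2) (Set.Icc 0 L ×ˢ Set.Ioo 0 T))
    {c d : ℝ} (h0c : 0 < c) (hcd : c < d) (hdT : d < T) {x : ℝ} (hx : x ∈ Set.Icc 0 L) :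
    ∫ y in (0:ℝ)..x, (u y d - u y c) = ∫ s in c..d, (ux x s - ux 0 s) := by
  have hJ : Set.Icc c d ⊆ Set.Ioo 0 T := Set.Icc_subset_Ioo h0c hdT
  have hc : c ∈ Set.Ioo 0 T := hJ ⟨le_rfl, hcd.le⟩
  have hd : d ∈ Set.Ioo 0 T := hJ ⟨hcd.le, le_rfl⟩
  have hgc : ContinuousOn (fun y => u y d - u y c) (Set.Icc 0 L) :=
    (huc.comp (f := fun x : ℝ => (x, d)) (by fun_prop)
      fun x hx => ⟨hx, Set.Ioo_subset_Icc_self hd⟩).sub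
    (huc.comp (f := fun x : ℝ => (x, c)) (by fun_prop)
      fun x hx => ⟨hx, Set.Ioo_subset_Icc_self hc⟩)
  have hgi : ∀ p ∈ Set.Icc 0 L, ∀ q ∈ Set.Icc 0 L,
      IntervalIntegrable (fun y => u y d - u y c) volume p q := fun p hp q hq =>
    (hgc.mono (Set.uIcc_subset_Icc hp hq)).intervalIntegrable
  have huxi : ∀ p ∈ Set.Icc 0 L, IntervalIntegrable (fun s => ux p s) volume c d := fun p hp => by
    refine (huxc.comp (f := fun s : ℝ => (p, s)) (by fun_prop)
      fun s hs => ⟨hp, hJ ?_⟩).intervalIntegrable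
    rwa [Set.uIcc_of_le hcd.le] at hs
  set Φ : ℝ → ℂ := fun x => (∫ s in c..d, ux x s) - ∫ y in (0:ℝ)..x, (u y d - u y c) with hΦ
  have hΦc : ContinuousOn Φ (Set.Icc 0 L) :=
    (ContinuousOn.intervalIntegral_param hL.le hcd.le
      (huxc.mono (Set.prod_mono_right hJ))).sub (hgc.intervalIntegral_primitive hL.le)
  have hconst : ∀ p ∈ Set.Ioo 0 L, ∀ q ∈ Set.Ioo 0 L, p ≤ q → Φ p = Φ q := by
    intro p hp q hq hpq
    have hp' := Set.Ioo_subset_Icc_self hp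
    have hq' := Set.Ioo_subset_Icc_self hq
    have h00 : (0:ℝ) ∈ Set.Icc 0 L := ⟨le_rfl, hL.le⟩
    have hφ : ∀ φ : ℂ →L[ℝ] ℝ, φ (Φ p) = φ (Φ q) := by
      intro φ
      have ha : p / 2 ∈ Set.Icc 0 L := ⟨by linarith [hp.1], by linarith [hp.1, hp.2]⟩
      obtain ⟨β, hβ⟩ := (hu.clm_comp φ).exists_integral_deriv_eq_real
        (φ.continuous.comp_continuousOn
          (huc.mono (Set.prod_mono Set.Ioo_subset_Icc_self Set.Ioo_subset_Icc_self)))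
        (φ.continuous.comp_continuousOn (huxc.mono (Set.prod_mono_left Set.Ioo_subset_Icc_self)))
        (a := p / 2) (b := (q + L) / 2) (by linarith [hp.1]) (by linarith [hp.1, hq.2])
        (by linarith [hq.2]) h0c hcd hdT
      have key : ∀ r ∈ Set.Icc 0 L, r ∈ Set.Ioo (p / 2) ((q + L) / 2) →
          φ (Φ r) = β - φ (∫ y in (0:ℝ)..(p / 2), (u y d - u y c)) := by
        intro r hr hr'
        have h1 := hβ r hr'
        rw [φ.intervalIntegral_comp_comm (huxi r hr)] at h1
        simp only [← map_sub] at h1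
        rw [φ.intervalIntegral_comp_comm (hgi _ ha r hr)] at h1
        simp only [hΦ, map_sub]
        rw [h1, ← intervalIntegral.integral_add_adjacent_intervals (hgi 0 h00 _ ha) (hgi _ ha r hr),
          map_add]
        ring
      rw [key p hp' ⟨by linarith [hp.1], by linarith [hq.2]⟩,
        key q hq' ⟨by linarith [hp.1], by linarith [hq.2]⟩]
    exact Complex.ext (hφ Complex.reCLM) (hφ Complex.imCLM)
  have hmid : L / 2 ∈ Set.Ioo 0 L := ⟨by linarith, by linarith⟩
  have hEq : Set.EqOn Φ (fun _ => Φ (L / 2)) (Set.Icc 0 L) := by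
    refine Set.EqOn.of_subset_closure (s := Set.Ioo 0 L) ?_ hΦc continuousOn_const
      Set.Ioo_subset_Icc_self (by rw [closure_Ioo hL.ne])
    intro p hp
    rcases le_total p (L / 2) with h | h
    · exact hconst p hp _ hmid h
    · exact (hconst _ hmid p hp h).symm
  have h00 : (0:ℝ) ∈ Set.Icc 0 L := ⟨le_rfl, hL.le⟩
  have hfin : Φ x = Φ 0 := (hEq hx).trans (hEq h00).symm
  simp only [hΦ, intervalIntegral.integral_same, sub_zero] at hfin
  rw [intervalIntegral.integral_sub (huxi x hx) (huxi 0 h00), ← hfin]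
  ring

theorem hasDerivAt_cexp_mul_ofReal (k : ℂ) (x : ℝ) :
    HasDerivAt (fun x : ℝ => Complex.exp (k * (x : ℂ))) (k * Complex.exp (k * (x : ℂ))) x := by
  have h := ((hasDerivAt_id (x : ℂ)).const_mul k).cexp.comp_ofReal
  exact h.congr_deriv (by simp [mul_comm])

/-- Integration by parts against an exponential. -/
theorem integral_cexp_mul_eq {L : ℝ} (hL : 0 ≤ L) (k : ℂ) {f f' : ℝ → ℂ}
    (hf : ContinuousOn f (Set.Icc 0 L)) (hf' : ContinuousOn f' (Set.Icc 0 L))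
    (hd : ∀ x ∈ Set.Ioo 0 L, HasDerivAt f (f' x) x) :
    ∫ x in (0:ℝ)..L, Complex.exp (k * (x : ℂ)) * f' x =
      Complex.exp (k * (L : ℂ)) * f L - f 0
        - k * ∫ x in (0:ℝ)..L, Complex.exp (k * (x : ℂ)) * f x := by
  have he : Continuous fun x : ℝ => Complex.exp (k * (x : ℂ)) := by fun_prop
  have hi : ∀ w : ℝ → ℂ, ContinuousOn w (Set.Icc 0 L) →
      IntervalIntegrable (fun x : ℝ => Complex.exp (k * (x : ℂ)) * w x) volume 0 L :=
    fun w hw => (he.continuousOn.mul (by rwa [Set.uIcc_of_le hL])).intervalIntegrable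
  have h := intervalIntegral.integral_eq_sub_of_hasDerivAt_of_le hL
    (f := fun x : ℝ => Complex.exp (k * (x : ℂ)) * f x)
    (f' := fun x : ℝ => k * (Complex.exp (k * (x : ℂ)) * f x) + Complex.exp (k * (x : ℂ)) * f' x)
    (he.continuousOn.mul hf)
    (fun x hx => ((hasDerivAt_cexp_mul_ofReal k x).mul (hd x hx)).congr_deriv (by ring))
    (((hi f hf).const_mul k).add (hi f' hf'))
  rw [intervalIntegral.integral_add ((hi f hf).const_mul k) (hi f' hf'),
    intervalIntegral.integral_const_mul] at h
  simp only [Complex.ofReal_zero, mul_zero, Complex.exp_zero, one_mul] at h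
  linear_combination h

/-- **Global relation on the finite interval.**
For a classical solution of the heat equation on `(0,L) × (0,T)` with
`u(0,t) = 0`, boundary data `h(t) = u(L,t)` and boundary fluxes
`g₁(t) = u_x(0,t)`, `h₁(t) = u_x(L,t)` continuous on `[0,T]`, if `u(·,T) ≡ 0`
then for every `λ ∈ ℂ`:
`0 = û₀(λ) + iλ e^{-iλL} ∫₀ᵀ e^{λ²s} h(s) ds - ∫₀ᵀ e^{λ²s} g₁(s) ds
   + e^{-iλL} ∫₀ᵀ e^{λ²s} h₁(s) ds`. -/
theorem finite_interval_global_relation (L T : ℝ) (hL : 0 < L) (hT : 0 < T)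
    (u ux uxx ut : ℝ → ℝ → ℂ) (h g₁ h₁ : ℝ → ℂ)
    (hu_cont : ContinuousOn (fun p : ℝ × ℝ => u p.1 p.2) (Set.Icc 0 L ×ˢ Set.Icc 0 T))
    (hux : ∀ t ∈ Set.Ioo (0:ℝ) T, ∀ x ∈ Set.Ioo (0:ℝ) L,
      HasDerivAt (fun y => u y t) (ux x t) x)
    (huxx : ∀ t ∈ Set.Ioo (0:ℝ) T, ∀ x ∈ Set.Ioo (0:ℝ) L,
      HasDerivAt (fun y => ux y t) (uxx x t) x)
    (hut : ∀ t ∈ Set.Ioo (0:ℝ) T, ∀ x ∈ Set.Ioo (0:ℝ) L,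
      HasDerivAt (fun s => u x s) (ut x t) t)
    (hheat : ∀ t ∈ Set.Ioo (0:ℝ) T, ∀ x ∈ Set.Ioo (0:ℝ) L, ut x t = uxx x t)
    (hux_cont : ContinuousOn (fun p : ℝ × ℝ => ux p.1 p.2)
      (Set.Icc 0 L ×ˢ Set.Ioo 0 T))
    (hdirichlet : ∀ t ∈ Set.Icc (0:ℝ) T, u 0 t = 0)
    (hhdef : ∀ t ∈ Set.Icc (0:ℝ) T, h t = u L t)
    (hg₁def : ∀ t ∈ Set.Ioo (0:ℝ) T, g₁ t = ux 0 t)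
    (hh₁def : ∀ t ∈ Set.Ioo (0:ℝ) T, h₁ t = ux L t)
    (hh_cont : ContinuousOn h (Set.Icc 0 T))
    (hg₁_cont : ContinuousOn g₁ (Set.Icc 0 T))
    (hh₁_cont : ContinuousOn h₁ (Set.Icc 0 T))
    (hfinal : ∀ x ∈ Set.Icc (0:ℝ) L, u x T = 0) :
    ∀ l : ℂ,
      0 = intervalFourier L (fun x => u x 0) l
          + Complex.I * l * Complex.exp (-Complex.I * l * (L : ℂ)) *
              (∫ s in (0:ℝ)..T, Complex.exp (l ^ 2 * (s : ℂ)) * h s)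
          - (∫ s in (0:ℝ)..T, Complex.exp (l ^ 2 * (s : ℂ)) * g₁ s)
          + Complex.exp (-Complex.I * l * (L : ℂ)) *
              ∫ s in (0:ℝ)..T, Complex.exp (l ^ 2 * (s : ℂ)) * h₁ s := by
  intro l
  have hu : IsPointwiseHeatOn u ux uxx (Set.Ioo 0 L) (Set.Ioo 0 T) :=
    ⟨hux, huxx, fun t ht x hx => hheat t ht x hx ▸ hut t ht x hx⟩
  have hJ : Set.Ioo 0 T ⊆ Set.Icc 0 T := Set.Ioo_subset_Icc_self
  have h0L : (0:ℝ) ∈ Set.Icc 0 L := ⟨le_rfl, hL.le⟩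
  have hLL : L ∈ Set.Icc 0 L := ⟨hL.le, le_rfl⟩
  set k : ℂ := -Complex.I * l with hk
  have hk2 : k ^ 2 = -l ^ 2 := by rw [hk, mul_pow, neg_sq, Complex.I_sq]; ring
  have he : Continuous fun x : ℝ => Complex.exp (k * (x : ℂ)) := by fun_prop
  have hut_slice : ∀ t ∈ Set.Icc 0 T, ContinuousOn (fun x => u x t) (Set.Icc 0 L) :=
    fun t ht => hu_cont.comp (f := fun x : ℝ => (x, t)) (by fun_prop) fun x hx => ⟨hx, ht⟩
  have hux_slice : ∀ t ∈ Set.Ioo 0 T, ContinuousOn (fun x => ux x t) (Set.Icc 0 L) :=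
    fun t ht => hux_cont.comp (f := fun x : ℝ => (x, t)) (by fun_prop) fun x hx => ⟨hx, ht⟩
  have hi : ∀ w : ℝ → ℂ, ContinuousOn w (Set.Icc 0 L) →
      IntervalIntegrable (fun x : ℝ => Complex.exp (k * (x : ℂ)) * w x) volume 0 L :=
    fun w hw => (he.continuousOn.mul (by rwa [Set.uIcc_of_le hL.le])).intervalIntegrable
  set M : ℝ → ℂ := fun t => ∫ x in (0:ℝ)..L, Complex.exp (k * (x : ℂ)) * u x t with hM
  set R : ℝ → ℂ := fun s => Complex.exp (k * (L : ℂ)) * h₁ s - g₁ s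
    - k * (Complex.exp (k * (L : ℂ)) * h s) with hR
  have hMc : ContinuousOn M (Set.Icc 0 T) := by
    refine ContinuousOn.intervalIntegral_param hT.le hL.le ?_
    refine ContinuousOn.mul (by fun_prop) ?_
    exact hu_cont.comp (f := fun p : ℝ × ℝ => (p.2, p.1)) (by fun_prop) fun p hp => ⟨hp.2, hp.1⟩
  have hRc : ContinuousOn R (Set.Icc 0 T) :=
    ((hh₁_cont.const_mul _).sub hg₁_cont).sub ((hh_cont.const_mul _).const_mul _)
  have hDc : ContinuousOn (fun s => R s - l ^ 2 * M s) (Set.Icc 0 T) :=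
    hRc.sub (hMc.const_mul _)
  have hflux : ∀ s ∈ Set.Ioo 0 T, Complex.exp (k * (L : ℂ)) * (ux L s - ux 0 s)
      - k * (∫ x in (0:ℝ)..L, Complex.exp (k * (x : ℂ)) * (ux x s - ux 0 s))
      = R s - l ^ 2 * M s := by
    intro s hs
    have h1 := integral_cexp_mul_eq hL.le k (f := fun x => u x s) (hut_slice s (hJ hs))
      (hux_slice s hs) (hux s hs)
    have h2 := integral_cexp_mul_eq hL.le k (f := fun _ => (1:ℂ)) (f' := fun _ => 0)
      continuousOn_const continuousOn_const fun x _ => hasDerivAt_const x 1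
    simp only [mul_zero, intervalIntegral.integral_zero, mul_one] at h2
    have h3 : (∫ x in (0:ℝ)..L, Complex.exp (k * (x : ℂ)) * (ux x s - ux 0 s)) =
        (∫ x in (0:ℝ)..L, Complex.exp (k * (x : ℂ)) * ux x s)
          - (∫ x in (0:ℝ)..L, Complex.exp (k * (x : ℂ))) * ux 0 s := by
      rw [← intervalIntegral.integral_mul_const, ← intervalIntegral.integral_sub
        (hi _ (hux_slice s hs)) (hi (fun _ => ux 0 s) continuousOn_const)]
      simp only [mul_sub]
    rw [h3, h1, hdirichlet s (hJ hs)]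
    simp only [hR, hM, hhdef s (hJ hs), hg₁def s hs, hh₁def s hs]
    linear_combination (∫ x in (0:ℝ)..L, Complex.exp (k * (x : ℂ)) * u x s) * hk2 + ux 0 s * h2
  have hincr : ∀ c d, 0 < c → c < d → d < T → M d - M c = ∫ s in c..d, (R s - l ^ 2 * M s) := by
    intro c d h0c hcd hdT
    have hcdT : Set.Icc c d ⊆ Set.Ioo 0 T := Set.Icc_subset_Ioo h0c hdT
    have hc := hJ (hcdT ⟨le_rfl, hcd.le⟩)
    have hd := hJ (hcdT ⟨hcd.le, le_rfl⟩)
    have hw : ContinuousOn (fun x => u x d - u x c) (Set.Icc 0 L) :=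
      (hut_slice d hd).sub (hut_slice c hc)
    have hparts := integral_cexp_mul_eq hL.le k (hw.intervalIntegral_primitive hL.le) hw
      fun x hx => hasDerivAt_intervalIntegral_of_continuousOn hw hx
    have hgreen := fun x hx => hu.integral_sub_eq_integral_deriv_sub (x := x) hL hu_cont hux_cont
      h0c hcd hdT hx
    have hqc : ContinuousOn (fun p : ℝ × ℝ => ux p.1 p.2 - ux 0 p.2)
        (Set.Icc 0 L ×ˢ Set.Icc c d) :=
      (hux_cont.mono (Set.prod_mono_right hcdT)).sub
        (hux_cont.comp (f := fun p : ℝ × ℝ => ((0:ℝ), p.2)) (by fun_prop)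
          fun p hp => ⟨h0L, hcdT hp.2⟩)
    have heqc : ContinuousOn
        (fun p : ℝ × ℝ => Complex.exp (k * (p.1 : ℂ)) * (ux p.1 p.2 - ux 0 p.2))
        (Set.Icc 0 L ×ˢ Set.Icc c d) := ContinuousOn.mul (by fun_prop) hqc
    have hswap := intervalIntegral_swap_of_continuousOn (f := fun x s =>
      Complex.exp (k * (x : ℂ)) * (ux x s - ux 0 s)) hL.le hcd.le heqc
    have hqL : IntervalIntegrable (fun s => ux L s - ux 0 s) volume c d := by
      refine (hqc.comp (f := fun s : ℝ => (L, s)) (by fun_prop)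
        fun s hs => ⟨hLL, ?_⟩).intervalIntegrable
      rwa [Set.uIcc_of_le hcd.le] at hs
    have hinner : IntervalIntegrable (fun s => ∫ x in (0:ℝ)..L,
        Complex.exp (k * (x : ℂ)) * (ux x s - ux 0 s)) volume c d := by
      refine ContinuousOn.intervalIntegrable ?_
      rw [Set.uIcc_of_le hcd.le]
      refine ContinuousOn.intervalIntegral_param (f := fun s x =>
        Complex.exp (k * (x : ℂ)) * (ux x s - ux 0 s)) hcd.le hL.le ?_
      exact heqc.comp (f := fun p : ℝ × ℝ => (p.2, p.1)) (by fun_prop) fun p hp => ⟨hp.2, hp.1⟩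
    calc M d - M c
        = ∫ x in (0:ℝ)..L, Complex.exp (k * (x : ℂ)) * (u x d - u x c) := by
          simp only [hM, mul_sub]
          exact (intervalIntegral.integral_sub (hi _ (hut_slice d hd))
            (hi _ (hut_slice c hc))).symm
      _ = Complex.exp (k * (L : ℂ)) * (∫ s in c..d, (ux L s - ux 0 s))
          - k * ∫ s in c..d, ∫ x in (0:ℝ)..L,
              Complex.exp (k * (x : ℂ)) * (ux x s - ux 0 s) := by
          refine hparts.trans ?_
          rw [← hswap, intervalIntegral.integral_same, sub_zero, hgreen L hLL]
          congr 2
          refine intervalIntegral.integral_congr fun x hx => ?_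
          rw [Set.uIcc_of_le hL.le] at hx
          simp only [intervalIntegral.integral_const_mul, hgreen x hx]
      _ = ∫ s in c..d, (Complex.exp (k * (L : ℂ)) * (ux L s - ux 0 s)
          - k * ∫ x in (0:ℝ)..L, Complex.exp (k * (x : ℂ)) * (ux x s - ux 0 s)) := by
          rw [intervalIntegral.integral_sub (hqL.const_mul _) (hinner.const_mul _),
            intervalIntegral.integral_const_mul, intervalIntegral.integral_const_mul]
      _ = ∫ s in c..d, (R s - l ^ 2 * M s) := by
          refine intervalIntegral.integral_congr fun s hs => ?_
          rw [Set.uIcc_of_le hcd.le] at hs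
          exact hflux s (hcdT hs)
  have hMd : ∀ t ∈ Set.Ioo 0 T, HasDerivAt M (R t - l ^ 2 * M t) t := by
    intro t ht
    have h1 : t / 2 < t := by linarith [ht.1]
    have h2 : t < (t + T) / 2 := by linarith [ht.2]
    have hsub : Set.Icc (t / 2) ((t + T) / 2) ⊆ Set.Icc 0 T :=
      Set.Icc_subset_Icc (by linarith [ht.1]) (by linarith [ht.2])
    refine ((hasDerivAt_intervalIntegral_of_continuousOn (hDc.mono hsub) ⟨h1, h2⟩).const_add
      (M (t / 2))).congr_of_eventuallyEq ?_
    filter_upwards [Ioo_mem_nhds h1 h2] with d hd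
    rw [← hincr _ d (by linarith [ht.1]) hd.1 (by linarith [hd.2, ht.2])]
    ring
  have hE : Continuous fun s : ℝ => Complex.exp (l ^ 2 * (s : ℂ)) := by fun_prop
  have hEi : ∀ w : ℝ → ℂ, ContinuousOn w (Set.Icc 0 T) →
      IntervalIntegrable (fun s : ℝ => Complex.exp (l ^ 2 * (s : ℂ)) * w s) volume 0 T :=
    fun w hw => (hE.continuousOn.mul (by rwa [Set.uIcc_of_le hT.le])).intervalIntegrable
  have hMT : M T = 0 := by
    have : M T = ∫ x in (0:ℝ)..L, (0:ℂ) := by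
      refine intervalIntegral.integral_congr fun x hx => ?_
      rw [Set.uIcc_of_le hL.le] at hx
      simp [hfinal x hx]
    simpa using this
  have hFTC := intervalIntegral.integral_eq_sub_of_hasDerivAt_of_le hT.le
    (f := fun s : ℝ => Complex.exp (l ^ 2 * (s : ℂ)) * M s)
    (f' := fun s : ℝ => Complex.exp (l ^ 2 * (s : ℂ)) * R s)
    (hE.continuousOn.mul hMc)
    (fun s hs => ((hasDerivAt_cexp_mul_ofReal (l ^ 2) s).mul (hMd s hs)).congr_deriv (by ring))
    (hEi R hRc)
  have hsplit : ∫ s in (0:ℝ)..T, Complex.exp (l ^ 2 * (s : ℂ)) * R s =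
      Complex.exp (k * (L : ℂ)) * (∫ s in (0:ℝ)..T, Complex.exp (l ^ 2 * (s : ℂ)) * h₁ s)
      - (∫ s in (0:ℝ)..T, Complex.exp (l ^ 2 * (s : ℂ)) * g₁ s)
      - k * Complex.exp (k * (L : ℂ)) *
        ∫ s in (0:ℝ)..T, Complex.exp (l ^ 2 * (s : ℂ)) * h s := by
    rw [← intervalIntegral.integral_const_mul, ← intervalIntegral.integral_const_mul,
      ← intervalIntegral.integral_sub ((hEi _ hh₁_cont).const_mul _) (hEi _ hg₁_cont),
      ← intervalIntegral.integral_sub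
        (((hEi _ hh₁_cont).const_mul _).sub (hEi _ hg₁_cont)) ((hEi _ hh_cont).const_mul _)]
    refine intervalIntegral.integral_congr fun s _ => ?_
    simp only [hR]
    ring
  rw [hsplit, hMT] at hFTC
  simp only [Complex.ofReal_zero, mul_zero, Complex.exp_zero, one_mul, zero_sub] at hFTC
  have hM0 : intervalFourier L (fun x => u x 0) l = M 0 := rfl
  rw [hM0]
  linear_combination -hFTC
end

section
/- (Symmetry of the global relation forces vanishing boundary flux contribution) Let T > 0, let u₀ be integrable on (0,∞), and let g, r : [0,T] → ℂ be continuous. Suppose that for every λ ∈ ℂ with Im λ ≤ 0, 0 = û₀(λ) − ∫₀ᵀ e^{λ²τ} r(τ) dτ − iλ ∫₀ᵀ e^{λ²τ} g(τ) dτ, and moreover g = 0 almost everywhere on (0,T). Then û₀(λ) = û₀(−λ) for every real λ, and consequently u₀ = 0 almost everywhere on (0,∞). -/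
open MeasureTheory

open scoped FourierTransform ContDiff

/-- An integrable function on `ℝ` whose Fourier transform vanishes identically is zero almost
everywhere. -/
lemma ae_eq_zero_of_fourier_eq_zero {f : ℝ → ℂ} (hf : Integrable f) (h : ∀ w, 𝓕 f w = 0) :
    ∀ᵐ x, f x = 0 := by
  refine ae_eq_zero_of_integral_contDiff_smul_eq_zero hf.locallyIntegrable fun φ hφ hφc ↦ ?_
  have hc : HasCompactSupport (Complex.ofRealCLM ∘ φ) := hφc.comp_left rfl
  have hs : ContDiff ℝ ∞ (Complex.ofRealCLM ∘ φ) := by fun_prop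
  set ψ := hc.toSchwartzMap hs with hψ
  set η : SchwartzMap ℝ ℂ := 𝓕⁻ ψ
  have hinv : 𝓕 (η : ℝ → ℂ) = ψ := by
    rw [← SchwartzMap.fourier_coe, FourierTransform.fourier_fourierInv_eq]
  have key : ∫ w, 𝓕 f w • η w = ∫ x, f x • 𝓕 (η : ℝ → ℂ) x := by
    simpa using! VectorFourier.integral_fourierIntegral_smul_eq_flip (μ := volume) (ν := volume)
      (L := innerₗ ℝ) Real.continuous_fourierChar continuous_inner hf η.integrable
  rw [hinv] at key
  simp only [h, zero_smul, integral_zero] at key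
  rw [key]
  exact integral_congr_ae (.of_forall fun x ↦ by simp [hψ, mul_comm])

/-- The Fourier transform of the extension by zero is the half-line transform. -/
lemma fourier_indicator_Ioi (f : ℝ → ℂ) (w : ℝ) :
    𝓕 ((Set.Ioi (0 : ℝ)).indicator f) w = halfFourier f ((2 * Real.pi * w : ℝ) : ℂ) := by
  rw [Real.fourier_real_eq_integral_exp_smul, halfFourier,
    ← integral_indicator measurableSet_Ioi]
  congr 1 with x
  by_cases hx : x ∈ Set.Ioi (0 : ℝ)
  · simp only [Set.indicator_of_mem hx, smul_eq_mul]
    congr 2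
    push_cast
    ring
  · simp [Set.indicator_of_notMem hx]

/-- An integrable function on the half-line with even half-line transform vanishes almost
everywhere. -/
lemma ae_eq_zero_of_halfFourier_even {f : ℝ → ℂ} (hf : IntegrableOn f (Set.Ioi 0))
    (h : ∀ l : ℝ, halfFourier f (l : ℂ) = halfFourier f (-(l : ℂ))) :
    ∀ᵐ x ∂(volume.restrict (Set.Ioi (0 : ℝ))), f x = 0 := by
  set G := (Set.Ioi (0 : ℝ)).indicator f with hG
  have hGi : Integrable G := (integrable_indicator_iff measurableSet_Ioi).2 hf
  have hodd : ∀ᵐ x, G x - G (-x) = 0 := by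
    refine ae_eq_zero_of_fourier_eq_zero (hGi.sub hGi.comp_neg) fun w ↦ ?_
    have hsub : 𝓕 (fun x ↦ G x - G (-x)) w = 𝓕 G w - 𝓕 (fun x ↦ G (-x)) w := by
      simp only [Real.fourier_eq, smul_sub]
      exact integral_sub ((Real.fourierIntegral_convergent_iff w).2 hGi)
        ((Real.fourierIntegral_convergent_iff w).2 hGi.comp_neg)
    have hneg : 𝓕 (fun x ↦ G (-x)) w = 𝓕 G (-w) :=
      Real.fourier_comp_linearIsometry (LinearIsometryEquiv.neg ℝ) G w
    rw [hsub, hneg, fourier_indicator_Ioi, fourier_indicator_Ioi, h, sub_eq_zero]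
    congr 1
    push_cast
    ring
  rw [ae_restrict_iff' measurableSet_Ioi]
  filter_upwards [hodd] with x hx hx0
  have hx' : -x ∉ Set.Ioi (0 : ℝ) := by simpa using (Set.mem_Ioi.1 hx0).le
  simpa [hG, Set.indicator_of_mem hx0, Set.indicator_of_notMem hx'] using hx

/-- **Symmetry of the global relation forces a vanishing boundary flux contribution.**
If the global relation with vanishing final state
`0 = û₀(λ) - ∫₀ᵀ e^{λ²τ} r(τ) dτ - iλ ∫₀ᵀ e^{λ²τ} g(τ) dτ` holds for all `Im λ ≤ 0`
and moreover `g = 0` a.e. on `(0,T)`, then `û₀(λ) = û₀(-λ)` for every real `λ`, and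
consequently `u₀ = 0` a.e. on `(0,∞)`. -/
theorem symmetry_forces_vanishing (T : ℝ) (hT : 0 < T)
    (u₀ : ℝ → ℂ) (hu₀ : IntegrableOn u₀ (Set.Ioi 0))
    (g r : ℝ → ℂ)
    (hg_cont : ContinuousOn g (Set.Icc 0 T))
    (hr_cont : ContinuousOn r (Set.Icc 0 T))
    (hGR : ∀ l : ℂ, l.im ≤ 0 →
      0 = halfFourier u₀ l
          - (∫ τ in (0:ℝ)..T, Complex.exp (l ^ 2 * (τ : ℂ)) * r τ)
          - Complex.I * l * ∫ τ in (0:ℝ)..T, Complex.exp (l ^ 2 * (τ : ℂ)) * g τ)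
    (hg0 : ∀ᵐ t ∂(volume.restrict (Set.Ioo (0:ℝ) T)), g t = 0) :
    (∀ l : ℝ, halfFourier u₀ (l : ℂ) = halfFourier u₀ (-(l : ℂ))) ∧
    (∀ᵐ x ∂(volume.restrict (Set.Ioi (0:ℝ))), u₀ x = 0) := by
  have hgint (l : ℂ) : ∫ τ in (0:ℝ)..T, Complex.exp (l ^ 2 * (τ : ℂ)) * g τ = 0 := by
    rw [intervalIntegral.integral_of_le hT.le, integral_Ioc_eq_integral_Ioo]
    refine integral_eq_zero_of_ae ?_
    filter_upwards [hg0] with t ht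
    simp [ht]
  have hrel (l : ℂ) (hl : l.im ≤ 0) :
      halfFourier u₀ l = ∫ τ in (0:ℝ)..T, Complex.exp (l ^ 2 * (τ : ℂ)) * r τ := by
    have := hGR l hl
    rw [hgint, mul_zero, sub_zero] at this
    exact sub_eq_zero.1 this.symm
  have heven (l : ℝ) : halfFourier u₀ (l : ℂ) = halfFourier u₀ (-(l : ℂ)) := by
    rw [hrel _ (by simp), hrel _ (by simp), neg_sq]
  exact ⟨heven, ae_eq_zero_of_halfFourier_even hu₀ heven⟩
end
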